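/- Let B be a real symmetric positive definite n×n matrix and let s, y ∈ ℝⁿ with sᵀy > 0 and s ≠ 0. Then the BFGS update B⁺ = B − (1/(sᵀBs)) B s sᵀ B + (1/(yᵀs)) y yᵀ is symmetric positive definite. -/

import Mathlib

open Matrix

/-- For symmetric `B`, the bilinear form `x ⬝ᵥ B *ᵥ z` is symmetric. -/
theorem Matrix.IsSymm.dotProduct_mulVec_comm {ι R : Type*} [Fintype ι] [CommSemiring R]
    {B : Matrix ι ι R} (hB : B.IsSymm) (x z : ι → R) : x ⬝ᵥ (B *ᵥ z) = z ⬝ᵥ (B *ᵥ x) := by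
  rw [dotProduct_mulVec, ← mulVec_transpose, hB.eq, dotProduct_comm]

/-- Completing the square: subtracting from `x` its `B`-projection onto `s`. -/
theorem Matrix.IsSymm.dotProduct_mulVec_sub_proj {ι K : Type*} [Fintype ι] [Field K]
    {B : Matrix ι ι K} (hB : B.IsSymm) {s : ι → K} (hs : s ⬝ᵥ (B *ᵥ s) ≠ 0) (x : ι → K) :
    (x - (s ⬝ᵥ (B *ᵥ x) / s ⬝ᵥ (B *ᵥ s)) • s) ⬝ᵥ
        (B *ᵥ (x - (s ⬝ᵥ (B *ᵥ x) / s ⬝ᵥ (B *ᵥ s)) • s)) =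
      x ⬝ᵥ (B *ᵥ x) - (s ⬝ᵥ (B *ᵥ x)) ^ 2 / s ⬝ᵥ (B *ᵥ s) := by
  simp only [mulVec_sub, mulVec_smul, sub_dotProduct, dotProduct_sub, smul_dotProduct,
    dotProduct_smul, smul_eq_mul, hB.dotProduct_mulVec_comm x s]
  field_simp
  ring

/-- The quadratic form of the BFGS update. -/
theorem dotProduct_bfgs_update_mulVec {ι K : Type*} [Fintype ι] [Field K]
    {B : Matrix ι ι K} (hB : B.IsSymm) (s y x : ι → K) (a b : K) :
    x ⬝ᵥ ((B - a • (B * vecMulVec s s * B) + b • vecMulVec y y) *ᵥ x) =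
      x ⬝ᵥ (B *ᵥ x) - a * (s ⬝ᵥ (B *ᵥ x)) ^ 2 + b * (y ⬝ᵥ x) ^ 2 := by
  simp only [add_mulVec, sub_mulVec, smul_mulVec, ← mulVec_mulVec, vecMulVec_mulVec,
    mulVec_smul, op_smul_eq_smul, dotProduct_add, dotProduct_sub, dotProduct_smul, smul_eq_mul,
    hB.dotProduct_mulVec_comm x s, dotProduct_comm x y]
  ring

/-- If `B` is symmetric positive definite and the curvature condition `sᵀy > 0` holds
(with `s ≠ 0`), then the BFGS update `B⁺ = B - (B s sᵀ B)/(sᵀ B s) + (y yᵀ)/(yᵀ s)`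
is symmetric positive definite. -/
theorem bfgs_update_posdef (n : ℕ) (B : Matrix (Fin n) (Fin n) ℝ)
    (hBsymm : B.IsSymm) (hBpd : B.PosDef)
    (s y : Fin n → ℝ) (hcurv : 0 < s ⬝ᵥ y) (hs : s ≠ 0) :
    (B - (1 / (s ⬝ᵥ (B *ᵥ s))) • (B * vecMulVec s s * B)
        + (1 / (y ⬝ᵥ s)) • vecMulVec y y).IsSymm ∧
    (B - (1 / (s ⬝ᵥ (B *ᵥ s))) • (B * vecMulVec s s * B)
        + (1 / (y ⬝ᵥ s)) • vecMulVec y y).PosDef := by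
  have hsymm : (B - (1 / (s ⬝ᵥ (B *ᵥ s))) • (B * vecMulVec s s * B)
      + (1 / (y ⬝ᵥ s)) • vecMulVec y y).IsSymm := by
    simp only [IsSymm, transpose_add, transpose_sub, transpose_smul, transpose_mul,
      transpose_vecMulVec, hBsymm.eq, Matrix.mul_assoc]
  refine ⟨hsymm, .of_dotProduct_mulVec_pos (isHermitian_iff_isSymm.mpr hsymm) fun x hx => ?_⟩
  have hsBs : 0 < s ⬝ᵥ (B *ᵥ s) := by simpa using hBpd.dotProduct_mulVec_pos hs
  have hys : 0 < y ⬝ᵥ s := dotProduct_comm s y ▸ hcurv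
  rw [star_trivial, dotProduct_bfgs_update_mulVec hBsymm, one_div_mul_eq_div,
    ← hBsymm.dotProduct_mulVec_sub_proj hsBs.ne']
  set t := s ⬝ᵥ (B *ᵥ x) / s ⬝ᵥ (B *ᵥ s)
  by_cases hz : x - t • s = 0
  · have hxt : x = t • s := sub_eq_zero.mp hz
    have ht : t ≠ 0 := fun h => hx (by rw [hxt, h, zero_smul])
    have hyx : y ⬝ᵥ x ≠ 0 := by
      rw [hxt, dotProduct_smul, smul_eq_mul]
      exact mul_ne_zero ht hys.ne'
    rw [hz, zero_dotProduct, zero_add]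
    positivity
  · have hpos : 0 < (x - t • s) ⬝ᵥ (B *ᵥ (x - t • s)) := by
      simpa only [star_trivial] using hBpd.dotProduct_mulVec_pos hz
    positivity
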